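/- arXiv:2604.02496 — 2 statements merged into one kernel-verified Lean document; each statement's English description precedes it below -/
import Mathlib

section
/- For every route R, the convex hull of the set Π(R) of recourse policies for R equals the polyhedron {y ∈ ℝ₊^{[N]×V₊} : y^ξ(R') ≥ k_ξ(R') − 1 for every subroute R' ⊆ R and every scenario ξ ∈ [N]}, where k_ξ(R') = ⌈d^ξ(R')/C⌉. -/
set_option autoImplicit false

open Finset

namespace VRPSD

variable {Vp : Type*} [Fintype Vp] [DecidableEq Vp]
variable {Sc : Type*} [Fintype Sc] [Nonempty Sc]

/-- Position `j` of the closed walk `0, v₁, …, v_ℓ, 0`: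
`j = 0` gives the depot (`none`), `1 ≤ j ≤ ℓ` gives customer `v_j`,
and `j ≥ ℓ + 1` gives the depot again. -/
def nodeAt (L : List Vp) (j : ℕ) : Option Vp :=
  if j = 0 then none else L[j-1]?

/-- Directed flow feasibility (Formulation (1) of the paper) witnessing recourse action `y`
for the directed route given by the list `L = [v₁, …, v_ℓ]`, demand vector `d` and
vehicle capacity `C`. -/
def FlowFeasible (C : ℚ) (d : Vp → ℚ) (L : List Vp) (y : Vp → ℝ) : Prop :=
  ∃ (f : Option Vp → Option Vp → ℝ) (g : Vp → ℝ),
    (∀ a b, 0 ≤ f a b) ∧ (∀ v, 0 ≤ g v) ∧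
    (∀ j : Fin L.length,
      f (nodeAt L j.val) (nodeAt L (j.val + 1)) + (d (L.get j) : ℝ)
        = f (nodeAt L (j.val + 1)) (nodeAt L (j.val + 2)) + g (L.get j)) ∧
    (∀ j : Fin (L.length + 1), f (nodeAt L j.val) (nodeAt L (j.val + 1)) ≤ (C : ℝ)) ∧
    (∀ j : Fin L.length, g (L.get j) ≤ (C : ℝ) * y (L.get j))

/-- `𝒴^ξ(→R)` : the set of recourse actions for the directed route `L` and a fixed scenario
with demand vector `d`: nonnegative integer vectors admitting a feasible flow. -/
def RecourseActions (C : ℚ) (d : Vp → ℚ) (L : List Vp) : Set (Vp → ℝ) :=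
  {y | (∀ v, 0 ≤ y v) ∧ (∀ v, ∃ m : ℤ, y v = (m : ℝ)) ∧ FlowFeasible C d L y}

/-- `Π(R)` : the set of recourse policies for route `L`. -/
def Policies (C : ℚ) (d : Sc → Vp → ℚ) (L : List Vp) : Set (Sc → Vp → ℝ) :=
  {y | ∀ ξ, y ξ ∈ RecourseActions C (d ξ) L}

/-- `[0,b]^N`. -/
def Box (b : Vp → ℤ) : Set (Sc → Vp → ℝ) :=
  {y | ∀ ξ v, 0 ≤ y ξ v ∧ y ξ v ≤ (b v : ℝ)}

/-- `x(δ(v))` for a customer `v`. -/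
noncomputable def degCust (x : Option Vp → Option Vp → ℝ) (v : Vp) : ℝ :=
  ∑ u ∈ univ.filter (fun u => u ≠ some v), x u (some v)

/-- `x(δ(0))`. -/
noncomputable def degDepot (x : Option Vp → Option Vp → ℝ) : ℝ :=
  ∑ u ∈ univ.filter (fun u => u ≠ (none : Option Vp)), x u none

/-- `x(E(S))` for a customer set `S`. -/
noncomputable def inSum (x : Option Vp → Option Vp → ℝ) (S : Finset Vp) : ℝ :=
  (1/2) * ∑ u ∈ S, ∑ v ∈ S.filter (fun v => v ≠ u), x (some u) (some v)

/-- The subtour-elimination polytope `𝒳_sub` (symmetric edge variables). -/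
def Xsub : Set (Option Vp → Option Vp → ℝ) :=
  {x | (∀ u v, x u v = x v u) ∧ (∀ u, x u u = 0) ∧
       (∀ u v, u ≠ v → 0 ≤ x u v ∧ x u v ≤ 2) ∧
       (∀ v : Vp, degCust x v = 2) ∧
       (∀ S : Finset Vp, S.Nonempty → inSum x S ≤ (S.card : ℝ) - 1)}

/-- `k_ξ(S) = ⌈d^ξ(S)/C⌉`. -/
def kxi (C : ℚ) (d : Vp → ℚ) (S : Finset Vp) : ℤ := ⌈(∑ v ∈ S, d v) / C⌉

/-- The CVRP-feasible polytope `𝒳_cvrp`. -/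
def Xcvrp (C : ℚ) (p : Sc → ℚ) (d : Sc → Vp → ℚ) (k : ℕ) :
    Set (Option Vp → Option Vp → ℝ) :=
  Xsub ∩ {x | degDepot x = 2 * (k : ℝ) ∧
    ∀ S : Finset Vp, S.Nonempty →
      inSum x S ≤ (S.card : ℝ) - ((⌈(∑ v ∈ S, ∑ ξ, p ξ * d ξ v) / C⌉ : ℤ) : ℝ)}

/-- A routing plan: a collection of routes whose customer sets partition `V₊`. -/
def IsRoutingPlan (Rs : List (List Vp)) : Prop :=
  (∀ L ∈ Rs, L ≠ [] ∧ L.Nodup) ∧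
  ∀ v : Vp, ∃! i : Fin Rs.length, v ∈ Rs.get i

/-- The incidence vector of the edges of a single route `L` (closed walk through the depot). -/
noncomputable def routeInc (L : List Vp) (u u' : Option Vp) : ℝ :=
  ∑ j ∈ Finset.range (L.length + 1),
    (if (nodeAt L j = u ∧ nodeAt L (j+1) = u') ∨ (nodeAt L j = u' ∧ nodeAt L (j+1) = u)
     then (1 : ℝ) else 0)

/-- The incidence vector `x̄` of a routing plan. -/
noncomputable def planInc (Rs : List (List Vp)) (u u' : Option Vp) : ℝ :=
  (Rs.map (fun L => routeInc L u u')).sum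

/-- The set `FLOW(x̄)`. -/
def FLOW (C : ℚ) (d : Sc → Vp → ℚ) (b : Vp → ℤ) (x : Option Vp → Option Vp → ℝ) :
    Set (Sc → Vp → ℝ) :=
  {y | y ∈ Box b ∧
    ∃ (f : Sc → Option Vp → Option Vp → ℝ) (g : Sc → Vp → ℝ),
      (∀ ξ a c, 0 ≤ f ξ a c) ∧ (∀ ξ v, 0 ≤ g ξ v) ∧
      (∀ ξ (v : Vp),
        (∑ u ∈ univ.filter (fun u => u ≠ some v), f ξ u (some v)) + (d ξ v : ℝ)
          = (∑ u ∈ univ.filter (fun u => u ≠ some v), f ξ (some v) u) + g ξ v) ∧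
      (∀ ξ (u u' : Option Vp), u ≠ u' → f ξ u u' ≤ ((C : ℝ)/2) * x u u') ∧
      (∀ ξ v, g ξ v ≤ (C : ℝ) * y ξ v)}

/-- The set `SRI(x̄)` (on the `y`-variables only). -/
def SRIy (C : ℚ) (d : Sc → Vp → ℚ) (b : Vp → ℤ) (x : Option Vp → Option Vp → ℝ) :
    Set (Sc → Vp → ℝ) :=
  {y | y ∈ Box b ∧ ∀ S : Finset Vp, S.Nonempty → ∀ ξ,
    ((kxi C (d ξ) S : ℝ) + inSum x S - (S.card : ℝ)) ≤ ∑ v ∈ S, y ξ v}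

/-- The recourse cost `Σ_ξ Σ_v p_ξ w_v y^ξ_v`. -/
noncomputable def cost (p : Sc → ℚ) (w : Vp → ℚ) (y : Sc → Vp → ℝ) : ℝ :=
  ∑ ξ, ∑ v, (p ξ : ℝ) * (w v : ℝ) * y ξ v

/-- `ν(α,β)`. -/
noncomputable def nu (C : ℚ) (d : Sc → Vp → ℚ) (b : Vp → ℤ)
    (α : Sc → Finset Vp → ℝ) (β : Sc → Vp → ℝ) : ℝ :=
  (∑ ξ, ∑ S ∈ univ.filter (fun S : Finset Vp => S ≠ ∅),
      α ξ S * ((kxi C (d ξ) S : ℝ) - (S.card : ℝ)))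
  + ∑ ξ, ∑ v, β ξ v * (b v : ℝ)

/-- `φ_v(α,β)` (only meaningful for `v` with `w v > 0`). -/
noncomputable def phiv (p : Sc → ℚ) (w : Vp → ℚ)
    (α : Sc → Finset Vp → ℝ) (β : Sc → Vp → ℝ) (v : Vp) : ℝ :=
  max (Finset.univ.sup' Finset.univ_nonempty
    (fun ξ => (β ξ v + ∑ S ∈ univ.filter (fun S : Finset Vp => v ∈ S), α ξ S)
      / ((p ξ : ℝ) * (w v : ℝ)))) 0

/-- The set `𝒜` of multipliers. -/
def multA (w : Vp → ℚ) (α : Sc → Finset Vp → ℝ) (β : Sc → Vp → ℝ) : Prop :=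
  (∀ ξ (S : Finset Vp), S ≠ ∅ → 0 ≤ α ξ S) ∧ (∀ ξ v, β ξ v ≤ 0) ∧
  (∀ ξ v, w v = 0 →
    β ξ v + (∑ S ∈ univ.filter (fun S : Finset Vp => v ∈ S), α ξ S) ≤ 0)

/-- The set `ŜRI(x̄)` of pairs `(θ, y)`. -/
def SRIhat (C : ℚ) (d : Sc → Vp → ℚ) (p : Sc → ℚ) (w : Vp → ℚ) (b : Vp → ℤ)
    (x : Option Vp → Option Vp → ℝ) : Set ((Vp → ℝ) × (Sc → Vp → ℝ)) :=
  {θy | (∀ v, 0 ≤ θy.1 v) ∧ θy.2 ∈ Box b ∧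
    (∀ S : Finset Vp, S.Nonempty → ∀ ξ,
      ((kxi C (d ξ) S : ℝ) + inSum x S - (S.card : ℝ)) ≤ ∑ v ∈ S, θy.2 ξ v) ∧
    (∀ v, (∑ ξ, (p ξ : ℝ) * (w v : ℝ) * θy.2 ξ v) ≤ θy.1 v)}

/-- The polyhedron `𝒫`. -/
def Pset (X : Set (Option Vp → Option Vp → ℝ)) (C : ℚ) (d : Sc → Vp → ℚ)
    (p : Sc → ℚ) (w : Vp → ℚ) (b : Vp → ℤ) :
    Set ((Option Vp → Option Vp → ℝ) × (Vp → ℝ)) :=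
  {xθ | xθ.1 ∈ X ∧ ∃ y, (xθ.2, y) ∈ SRIhat C d p w b xθ.1}

/-- The set `Γ(x̄, α, β)`. -/
def GammaSet (C : ℚ) (d : Sc → Vp → ℚ) (p : Sc → ℚ) (w : Vp → ℚ) (b : Vp → ℤ)
    (x : Option Vp → Option Vp → ℝ) (α : Sc → Finset Vp → ℝ) (β : Sc → Vp → ℝ) :
    Set ((Vp → ℝ) × (Sc → Vp → ℝ)) :=
  {θy | (∀ v, 0 ≤ θy.1 v) ∧ θy.2 ∈ Box b ∧
    ((∑ ξ, ∑ S ∈ univ.filter (fun S : Finset Vp => S ≠ ∅), α ξ S * inSum x S)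
        + nu C d b α β
      ≤ ∑ ξ, ∑ v, (β ξ v + ∑ S ∈ univ.filter (fun S : Finset Vp => v ∈ S), α ξ S)
          * θy.2 ξ v) ∧
    (∀ v, (∑ ξ, (p ξ : ℝ) * (w v : ℝ) * θy.2 ξ v) ≤ θy.1 v)}

/-- `V₊(H)` for a partial route given as a list of customer sets. -/
def VplusH (Hs : List (Finset Vp)) : Finset Vp := Hs.foldr (· ∪ ·) ∅

/-- `x(E(S,T))` for disjoint customer sets `S`, `T`. -/
noncomputable def crossSum (x : Option Vp → Option Vp → ℝ) (S T : Finset Vp) : ℝ :=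
  ∑ u ∈ S, ∑ v ∈ T, x (some u) (some v)

/-- `x(H)` for a partial route `H`. -/
noncomputable def xH (x : Option Vp → Option Vp → ℝ) (Hs : List (Finset Vp)) : ℝ :=
  (Hs.map (fun S => inSum x S)).sum
    + (List.zipWith (fun S T => crossSum x S T) Hs Hs.tail).sum

/-- The activation function `W_OF(x ; H)`. -/
noncomputable def WOF (x : Option Vp → Option Vp → ℝ) (Hs : List (Finset Vp)) : ℝ :=
  1 + (xH x Hs - ((VplusH Hs).card : ℝ) + 1)
    + ∑ i ∈ ({2, Hs.length - 1} : Finset ℕ) ∩ Finset.Icc 1 Hs.length,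
        (inSum x (Hs.getD (i-1) ∅) - ((Hs.getD (i-1) ∅).card : ℝ) + 1)

/-- A partial route: pairwise disjoint nonempty customer sets,
no two consecutive non-singletons. -/
def IsPartialRoute (Hs : List (Finset Vp)) : Prop :=
  Hs ≠ [] ∧ (∀ S ∈ Hs, S.Nonempty) ∧ Hs.Pairwise Disjoint ∧
  Hs.Chain' (fun S T => S.card = 1 ∨ T.card = 1)

/-- Indices `(i,j)`, `i ≤ j`, of the contiguous sub-tuples of a partial route. -/
def segIdx (Hs : List (Finset Vp)) : Finset (ℕ × ℕ) :=
  (Finset.range Hs.length ×ˢ Finset.range Hs.length).filter fun q => q.1 ≤ q.2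

/-- The customer set `V₊(H')` of the contiguous sub-tuple `H' = (S_i, …, S_j)` (0-based). -/
def seg (Hs : List (Finset Vp)) (i j : ℕ) : Finset Vp :=
  VplusH ((Hs.drop i).take (j + 1 - i))

/-- `cᵀ x` for symmetric edge functions. -/
noncomputable def dotE (c x : Option Vp → Option Vp → ℝ) : ℝ :=
  (1/2) * ∑ u : Option Vp, ∑ v ∈ univ.filter (fun v => v ≠ u), c u v * x u v

end VRPSD

namespace VRPSD

variable {Vp : Type*} [Fintype Vp] [DecidableEq Vp]
variable {Sc : Type*} [Fintype Sc] [Nonempty Sc]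

theorem aux_take_sum {Vp : Type*} (L : List Vp) (h : Vp → ℝ) (n : ℕ) (hn : n < L.length) :
    ((L.take (n+1)).map h).sum = ((L.take n).map h).sum + h L[n] := by
  rw [List.take_succ_eq_append_getElem hn, List.map_append, List.sum_append]; simp

theorem aux_cast {Vp : Type*} (L : List Vp) (d : Vp → ℚ) :
    (((L.map d).sum : ℚ) : ℝ) = (L.map (fun v => (d v : ℝ))).sum := by
  induction L with
  | nil => simp
  | cons a l ih => simp [ih]

theorem aux_infix {Vp : Type*} {L L' : List Vp} (h : L' <:+: L) :
    ∃ i j, i ≤ j ∧ j ≤ L.length ∧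
      ∀ h : Vp → ℝ, (L'.map h).sum = ((L.take j).map h).sum - ((L.take i).map h).sum := by
  obtain ⟨s, t, rfl⟩ := h
  refine ⟨s.length, s.length + L'.length, by omega, by simp, ?_⟩
  intro h
  have h1 : (s ++ L' ++ t).take (s.length + L'.length) = s ++ L' := by
    rw [← List.length_append]; exact List.take_left
  have h2 : (s ++ L' ++ t).take (s.length) = s := by
    rw [List.append_assoc]; exact List.take_left
  rw [h1, h2]; simp

theorem aux_seg {Vp : Type*} (L : List Vp) (i j : ℕ) (hij : i < j) (hj : j ≤ L.length) :
    ∃ L' : List Vp, L' ≠ [] ∧ L' <:+: L ∧ 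
      ∀ h : Vp → ℝ, (L'.map h).sum = ((L.take j).map h).sum - ((L.take i).map h).sum := by
  refine ⟨(L.take j).drop i, ?_, ?_, ?_⟩
  · intro h
    have := congrArg List.length h
    simp at this; omega
  · exact (List.drop_suffix _ _).isInfix.trans (List.take_prefix _ _).isInfix
  · intro h
    have h1 : (L.take j) = (L.take i) ++ (L.take j).drop i := by
      conv_lhs => rw [← List.take_append_drop i (L.take j)]
      rw [List.take_take, min_eq_left hij.le]
    have := congrArg (fun l => (l.map h).sum) h1
    simp only [List.map_append, List.sum_append] at this
    linarith

theorem aux_necess {Vp : Type*} [DecidableEq Vp] (C : ℚ) (hC : 0 < C) (d : Vp → ℚ)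
    (L : List Vp) (y : Vp → ℝ) (hy : y ∈ RecourseActions C d L)
    (L' : List Vp) (hL' : L' <:+: L) :
    ((⌈((L'.map d).sum) / C⌉ : ℤ) : ℝ) - 1 ≤ (L'.map y).sum := by
  obtain ⟨hy0, hyi, f, g, hf0, hg0, hbal, hcap, hg⟩ := hy
  obtain ⟨i, j, hij, hj, hs⟩ := aux_infix hL'
  have hCR : (0:ℝ) < C := by exact_mod_cast hC
  have key : ∀ m, m ≤ L.length →
      f (nodeAt L 0) (nodeAt L 1) + ((L.take m).map (fun v => (d v : ℝ))).sum
        = f (nodeAt L m) (nodeAt L (m+1)) + ((L.take m).map g).sum := by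
    intro m
    induction m with
    | zero => simp
    | succ m ih =>
      intro hm
      have := hbal ⟨m, hm⟩
      simp only [List.get_eq_getElem] at this
      rw [aux_take_sum _ _ _ hm, aux_take_sum _ _ _ hm]
      have := ih (by omega)
      linarith
  have hgs : (L'.map g).sum ≤ C * (L'.map y).sum := by
    rw [← List.sum_map_mul_left]
    apply List.sum_le_sum
    intro v hv
    obtain ⟨n, hn, rfl⟩ := List.getElem_of_mem (hL'.subset hv)
    exact hg ⟨n, hn⟩
  have h1 := key i (by omega)
  have h2 := key j hj
  have h3 := hcap ⟨j, by omega⟩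
  have h4 := hf0 (nodeAt L i) (nodeAt L (i+1))
  have h5 := hs (fun v => (d v : ℝ))
  have h6 := hs g
  simp only at h3
  have h7 : (L'.map (fun v => (d v : ℝ))).sum ≤ C + C * (L'.map y).sum := by
    generalize (L'.map (fun v => (d v : ℝ))).sum = a1 at *
    generalize ((L.take i).map (fun v => (d v : ℝ))).sum = a2 at *
    generalize ((L.take j).map (fun v => (d v : ℝ))).sum = a3 at *
    linarith
  choose m hm using hyi
  have h8 : (L'.map y).sum = (((L'.map m).sum : ℤ) : ℝ) := by
    clear * - hm
    induction L' with
    | nil => simp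
    | cons a l ih => simp [ih, hm]
  rw [h8] at h7 ⊢
  rw [← aux_cast] at h7
  generalize (L'.map m).sum = M at *
  generalize (L'.map d).sum = D at *
  have h9 : D ≤ C + C * ((M : ℤ) : ℚ) := by exact_mod_cast h7
  have h10 : ⌈(D) / C⌉ ≤ M + 1 := by
    rw [Int.ceil_le, div_le_iff₀ hC]
    push_cast
    linarith
  have : ((⌈(D) / C⌉ : ℤ) : ℝ) ≤ ((M : ℤ) : ℝ) + 1 := by exact_mod_cast h10
  linarith

/-- Greedy flow. -/
noncomputable def auxF {Vp : Type*} (L : List Vp) (w : Vp → ℝ) : ℕ → ℝ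
  | 0 => 0
  | n+1 => max 0 (auxF L w n + (L[n]?.map w).getD 0)

theorem auxF_nonneg {Vp : Type*} (L : List Vp) (w : Vp → ℝ) (n : ℕ) : 0 ≤ auxF L w n := by
  cases n with
  | zero => simp [auxF]
  | succ n => simp [auxF]

theorem auxF_succ {Vp : Type*} (L : List Vp) (w : Vp → ℝ) (n : ℕ) (hn : n < L.length) :
    auxF L w (n+1) = max 0 (auxF L w n + w L[n]) := by
  simp [auxF, hn]

theorem auxF_eq {Vp : Type*} (L : List Vp) (w : Vp → ℝ) (n : ℕ) (hn : n ≤ L.length) :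
    ∃ i ≤ n, auxF L w n = ((L.take n).map w).sum - ((L.take i).map w).sum := by
  induction n with
  | zero => exact ⟨0, le_rfl, by simp [auxF]⟩
  | succ n ih =>
    obtain ⟨i, hi, h⟩ := ih (by omega)
    rw [auxF_succ _ _ _ hn]
    rcases max_choice 0 (auxF L w n + w L[n]) with h' | h'
    · exact ⟨n+1, le_rfl, by rw [h']; simp⟩
    · refine ⟨i, by omega, ?_⟩
      rw [h', h, aux_take_sum _ _ _ hn]; ring

theorem aux_suff {Vp : Type*} [DecidableEq Vp] (C : ℚ) (hC : 0 < C) (d : Vp → ℚ)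
    (hd : ∀ v, 0 ≤ d v)
    (L : List Vp) (hnd : L.Nodup) (y : Vp → ℝ) (hy0 : ∀ v, 0 ≤ y v)
    (hy : ∀ L' : List Vp, L' ≠ [] → L' <:+: L →
      ((⌈((L'.map d).sum) / C⌉ : ℤ) : ℝ) - 1 ≤ (L'.map y).sum) :
    FlowFeasible C d L y := by
  have hCR : (0:ℝ) < C := by exact_mod_cast hC
  have hdR : ∀ v, (0:ℝ) ≤ d v := fun v => by exact_mod_cast hd v
  set w : Vp → ℝ := fun v => (d v : ℝ) - C * y v with hw
  let F := auxF L w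
  let idx : Option Vp → ℕ := fun a => a.elim 0 (fun v => L.idxOf v + 1)
  have hidx : ∀ j, j ≤ L.length → idx (nodeAt L j) = j := by
    intro j hj
    cases j with
    | zero => simp [nodeAt, idx]
    | succ n =>
      have hn : n < L.length := hj
      simp [nodeAt, idx, hn, hnd.idxOf_getElem]
  have hFC : ∀ n ≤ L.length, F n ≤ C := by
    intro n hn
    obtain ⟨i, hi, h⟩ := auxF_eq L w n hn
    change auxF L w n ≤ C
    rcases hi.eq_or_lt with rfl | hlt
    · rw [h]; simp [hCR.le]
    · obtain ⟨L', hne, hinf, hs⟩ := aux_seg L i n hlt hn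
      rw [h, ← hs]
      have h1 := hy L' hne hinf
      have h2 : (L'.map w).sum = (((L'.map d).sum : ℚ) : ℝ) - C * (L'.map y).sum := by
        rw [aux_cast, hw]
        clear * -
        induction L' with
        | nil => simp
        | cons a l ih => simp only [List.map_cons, List.sum_cons, ih]; ring
      have h3 : (L'.map d).sum ≤ ⌈((L'.map d).sum) / C⌉ * C := by
        rw [← div_le_iff₀ hC]; exact Int.le_ceil _
      have h4 : (((L'.map d).sum : ℚ) : ℝ) ≤ ((⌈((L'.map d).sum) / C⌉ : ℤ) : ℝ) * C := by
        exact_mod_cast h3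
      rw [h2]
      nlinarith
  refine ⟨fun a _ => F (idx a), 
    fun v => if v ∈ L then F (L.idxOf v) + d v - F (L.idxOf v + 1) else 0, 
    fun a b => auxF_nonneg _ _ _, ?_, ?_, ?_, ?_⟩
  · intro v
    dsimp only
    split_ifs with hv
    · obtain ⟨n, hn, rfl⟩ := List.getElem_of_mem hv
      rw [hnd.idxOf_getElem]
      have h1 : F (n+1) = _ := auxF_succ L w n hn
      have h2 : 0 ≤ F n := auxF_nonneg _ _ _
      have : F (n+1) ≤ F n + d L[n] := by
        rw [h1]
        apply max_le
        · have := hdR L[n]; linarith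
        · have := mul_nonneg hCR.le (hy0 L[n])
          change F n + ((d L[n] : ℝ) - C * y L[n]) ≤ _
          linarith
      linarith
    · exact le_rfl
  · rintro ⟨j, hj⟩
    simp only [List.get_eq_getElem]
    rw [hidx _ hj.le, hidx _ hj, hnd.idxOf_getElem]
    simp
  · rintro ⟨j, hj⟩
    simp only
    rw [hidx _ (by omega)]
    exact hFC _ (by omega)
  · rintro ⟨j, hj⟩
    simp only [List.get_eq_getElem]
    rw [hnd.idxOf_getElem, if_pos (List.getElem_mem _)]
    have h1 : F (j+1) = _ := auxF_succ L w j hj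
    have : F j + w L[j] ≤ F (j+1) := by rw [h1]; exact le_max_right _ _
    have h3 : w L[j] = d L[j] - C * y L[j] := rfl
    linarith

/-- Threshold rounding. -/
noncomputable def auxT {Vp : Type*} [DecidableEq Vp] (L : List Vp) (y : Vp → ℝ) (t : ℝ) (v : Vp) :
    ℝ :=
  ((⌊((L.take (L.idxOf v)).map y).sum + y v + t⌋ : ℤ) : ℝ) -
    ((⌊((L.take (L.idxOf v)).map y).sum + t⌋ : ℤ) : ℝ)

theorem auxT_prefix {Vp : Type*} [DecidableEq Vp] (L : List Vp) (hnd : L.Nodup)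
    (y : Vp → ℝ) (t : ℝ) (n : ℕ) (hn : n ≤ L.length) :
    ((L.take n).map (auxT L y t)).sum = 
      ((⌊((L.take n).map y).sum + t⌋ : ℤ) : ℝ) - ((⌊t⌋ : ℤ) : ℝ) := by
  induction n with
  | zero => simp
  | succ n ih =>
    rw [aux_take_sum _ _ _ hn, aux_take_sum _ _ _ hn, ih (by omega), auxT, hnd.idxOf_getElem]
    ring

theorem auxT_mem {Vp : Type*} [DecidableEq Vp] (C : ℚ) (hC : 0 < C) (d : Vp → ℚ)
    (hd : ∀ v, 0 ≤ d v)
    (L : List Vp) (hnd : L.Nodup) (y : Vp → ℝ) (hy0 : ∀ v, 0 ≤ y v)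
    (hy : ∀ L' : List Vp, L' ≠ [] → L' <:+: L →
      ((⌈((L'.map d).sum) / C⌉ : ℤ) : ℝ) - 1 ≤ (L'.map y).sum) (t : ℝ) :
    auxT L y t ∈ RecourseActions C d L := by
  have h0 : ∀ v, 0 ≤ auxT L y t v := by
    intro v
    unfold auxT
    rw [sub_nonneg]
    have := hy0 v
    exact_mod_cast Int.floor_le_floor (by linarith)
  refine ⟨h0, fun v => ⟨_, by unfold auxT; rw [← Int.cast_sub]⟩, 
    aux_suff C hC d hd L hnd _ h0 ?_⟩
  intro L' hne hinf
  have h1 := hy L' hne hinf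
  obtain ⟨i, j, hij, hj, hs⟩ := aux_infix hinf
  rw [hs, auxT_prefix L hnd y t i (by omega), auxT_prefix L hnd y t j hj]
  rw [hs] at h1
  generalize ((L.take i).map y).sum = a at *
  generalize ((L.take j).map y).sum = b at *
  generalize ⌈((L'.map d).sum) / C⌉ = k at *
  have h2 : ⌊a + t⌋ + (k - 1) ≤ ⌊b + t⌋ := by
    rw [Int.le_floor]
    push_cast
    have := Int.floor_le (a + t)
    linarith
  have h3 : ((⌊a + t⌋ : ℤ) : ℝ) + (k - 1) ≤ ((⌊b + t⌋ : ℤ) : ℝ) := by exact_mod_cast h2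
  linarith

open MeasureTheory in
theorem aux_floor_integrable (a : ℝ) :
    Integrable (fun t : ℝ => ((⌊a + t⌋ : ℤ) : ℝ)) (volume.restrict (Set.Ico (0:ℝ) 1)) := by
  refine Measure.integrableOn_of_bounded (M := |a| + 2) (by simp) ?_ ?_
  · have : Measurable (fun t : ℝ => ((⌊a + t⌋ : ℤ) : ℝ)) := by fun_prop
    exact this.aestronglyMeasurable
  · refine (ae_restrict_iff' measurableSet_Ico).2 (Filter.Eventually.of_forall ?_)
    rintro t ⟨ht0, ht1⟩
    have h1 := Int.floor_le (a + t)
    have h2 := Int.lt_floor_add_one (a + t)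
    have h3 := neg_abs_le a
    have h4 := le_abs_self a
    rw [Real.norm_eq_abs, abs_le]
    constructor <;> linarith

open MeasureTheory in
theorem aux_floor_integral (a : ℝ) :
    ∫ t in Set.Ico (0:ℝ) 1, ((⌊a + t⌋ : ℤ) : ℝ) = a := by
  have h1 : ∫ t in Set.Ico (0:ℝ) 1, ((⌊a + t⌋ : ℤ) : ℝ) =
      ∫ t in Set.Ico (0:ℝ) 1, ((⌊a⌋ : ℝ) + (Set.Ico (1 - Int.fract a) 1).indicator (fun _ => (1:ℝ)) t) := by
    refine setIntegral_congr_fun measurableSet_Ico ?_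
    rintro t ⟨ht0, ht1⟩
    have h := Int.floor_add_fract a
    have hf0 := Int.fract_nonneg a
    have hf1 := Int.fract_lt_one a
    dsimp only
    by_cases hc : 1 - Int.fract a ≤ t
    · rw [Set.indicator_of_mem (by exact ⟨hc, ht1⟩)]
      have : ⌊a + t⌋ = ⌊a⌋ + 1 := by
        rw [Int.floor_eq_iff]; push_cast
        constructor <;> linarith
      rw [this]; push_cast; ring
    · rw [Set.indicator_of_notMem (fun h => hc h.1)]
      push Not at hc
      have : ⌊a + t⌋ = ⌊a⌋ := by
        rw [Int.floor_eq_iff]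
        constructor <;> linarith
      rw [this]; ring
  have hf0 := Int.fract_nonneg a
  have hf1 := Int.fract_lt_one a
  rw [h1, integral_add (by simp) 
    ((integrable_const (1:ℝ)).indicator measurableSet_Ico), 
    setIntegral_indicator measurableSet_Ico,
    Set.inter_eq_self_of_subset_right (Set.Ico_subset_Ico_left (by linarith))]
  simp [hf0, Int.floor_add_fract]

/-- Theorem 1 of the paper: the convex hull of the recourse policies of a
route is cut out by the inequalities `y^ξ(R') ≥ k_ξ(R') − 1` over subroutes and
scenarios, together with nonnegativity. -/
theorem statement_2
    (C : ℚ) (hC : 0 < C) (d : Sc → Vp → ℚ)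
    (hd : ∀ ξ v, 0 ≤ d ξ v) (hdC : ∀ ξ v, d ξ v ≤ C)
    (L : List Vp) (hL : L ≠ []) (hnd : L.Nodup) :
    convexHull ℝ (Policies C d L) =
      {y : Sc → Vp → ℝ | (∀ ξ v, 0 ≤ y ξ v) ∧
        ∀ (ξ : Sc) (L' : List Vp), L' ≠ [] → L' <:+: L →
          ((⌈((L'.map (d ξ)).sum) / C⌉ : ℤ) : ℝ) - 1 ≤ (L'.map (y ξ)).sum} := by
  apply Set.Subset.antisymm
  · refine convexHull_min ?_ ?_
    · intro y hy
      exact ⟨fun ξ v => (hy ξ).1 v, fun ξ L' _ hinf => aux_necess C hC (d ξ) L (y ξ) (hy ξ) L' hinf⟩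
    · rintro x ⟨hx0, hx⟩ y ⟨hy0, hy⟩ a b ha hb hab
      refine ⟨fun ξ v => ?_, fun ξ L' hne hinf => ?_⟩
      · exact add_nonneg (mul_nonneg ha (hx0 ξ v)) (mul_nonneg hb (hy0 ξ v))
      · have h1 := hx ξ L' hne hinf
        have h2 := hy ξ L' hne hinf
        have h3 : (L'.map ((a • x + b • y) ξ)).sum = a * (L'.map (x ξ)).sum + b * (L'.map (y ξ)).sum := by
          rw [← List.sum_map_mul_left, ← List.sum_map_mul_left, ← List.sum_map_add]
          rfl
        rw [h3]
        generalize ((⌈((L'.map (d ξ)).sum) / C⌉ : ℤ) : ℝ) - 1 = k at *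
        calc k = a * k + b * k := by rw [← add_mul, hab, one_mul]
          _ ≤ _ := add_le_add (mul_le_mul_of_nonneg_left h1 ha) (mul_le_mul_of_nonneg_left h2 hb)
  · rintro y ⟨hy0, hy⟩
    let T : ℝ → Sc → Vp → ℝ := fun t ξ => auxT L (y ξ) t
    have hT : ∀ t, T t ∈ Policies C d L := fun t ξ =>
      auxT_mem C hC (d ξ) (hd ξ) L hnd (y ξ) (hy0 ξ) (hy ξ) t
    have hfin : (Set.range T).Finite := by
      have hf : (Set.univ.pi (fun ξ : Sc => Set.univ.pi (fun v : Vp => 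
          (fun m : ℤ => (m : ℝ)) '' Set.Icc (⌊y ξ v⌋ - 1) (⌊y ξ v⌋ + 2)))).Finite :=
        Set.Finite.pi' (fun ξ => Set.Finite.pi' (fun v => (Set.finite_Icc _ _).image _)) |>.subset 
          (fun x hx ξ v => hx ξ trivial v trivial)
      refine hf.subset ?_
      rintro _ ⟨t, rfl⟩ ξ - v -
      refine ⟨_, ?_, Int.cast_sub _ _⟩
      generalize (List.map (y ξ) (List.take (List.idxOf v L) L)).sum = p
      have h1 := Int.floor_le (p + y ξ v + t)
      have h2 := Int.lt_floor_add_one (p + y ξ v + t)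
      have h3 := Int.floor_le (p + t)
      have h4 := Int.lt_floor_add_one (p + t)
      have h5 := Int.floor_le (y ξ v)
      have h6 := Int.lt_floor_add_one (y ξ v)
      constructor
      · have : ((⌊y ξ v⌋ : ℤ) : ℝ) < ((⌊p + y ξ v + t⌋ - ⌊p + t⌋ + 1 : ℤ) : ℝ) := by
          push_cast; linarith
        have := Int.cast_lt.1 this
        omega
      · have : ((⌊p + y ξ v + t⌋ - ⌊p + t⌋ : ℤ) : ℝ) < ((⌊y ξ v⌋ + 2 : ℤ) : ℝ) := by
          push_cast; linarith
        have := Int.cast_lt.1 this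
        omega
    have hclosed := hfin.isClosed_convexHull ℝ
    let μ : MeasureTheory.Measure ℝ := MeasureTheory.volume.restrict (Set.Ico (0:ℝ) 1)
    have hμ : MeasureTheory.IsProbabilityMeasure μ := ⟨by simp [μ]⟩
    have hi1 : ∀ ξ v, MeasureTheory.Integrable (fun t => T t ξ v) μ := fun ξ v => by
      have h1 := aux_floor_integrable (((L.take (L.idxOf v)).map (y ξ)).sum + y ξ v)
      have h2 := aux_floor_integrable (((L.take (L.idxOf v)).map (y ξ)).sum)
      exact h1.sub h2
    have hi2 : ∀ ξ, MeasureTheory.Integrable (fun t => T t ξ) μ := fun ξ =>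
      MeasureTheory.Integrable.of_eval (hi1 ξ)
    have hi3 : MeasureTheory.Integrable T μ := MeasureTheory.Integrable.of_eval hi2
    have hmem := (convex_convexHull ℝ (Set.range T)).integral_mem (μ := μ) (f := T) hclosed
      (Filter.Eventually.of_forall (fun t => subset_convexHull ℝ _ ⟨t, rfl⟩)) hi3
    have hint : ∫ t, T t ∂μ = y := by
      funext ξ v
      rw [MeasureTheory.eval_integral hi2, MeasureTheory.eval_integral (hi1 ξ)]
      have h1 := aux_floor_integrable (((L.take (L.idxOf v)).map (y ξ)).sum + y ξ v)
      have h2 := aux_floor_integrable (((L.take (L.idxOf v)).map (y ξ)).sum)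
      refine (MeasureTheory.integral_sub h1 h2).trans ?_
      rw [aux_floor_integral, aux_floor_integral]; ring
    rw [hint] at hmem
    refine convexHull_mono ?_ hmem
    rintro _ ⟨t, rfl⟩
    exact hT t

end VRPSD
end

section
/- Fix b ∈ ℤ₊^{V₊}. For x̄ ∈ 𝒳 define SRI(x̄) := {y ∈ [0,b]^N : y^ξ(S) ≥ k_ξ(S) + x̄(E(S)) − |S| for every nonempty S ⊆ V₊ and every ξ ∈ [N]}, where y^ξ(S) := Σ_{v∈S} y^ξ_v and k_ξ(S) := ⌈d^ξ(S)/C⌉. Then for every x̄ ∈ 𝒳 ∩ ℤ^E, SRI(x̄) = conv(Π(x̄) ∩ [0,b]^N). -/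
set_option autoImplicit false

open Finset

namespace VRPSD

variable {Vp : Type*} [Fintype Vp] [DecidableEq Vp]
variable {Sc : Type*} [Fintype Sc] [Nonempty Sc]

/-- Extension of a customer function by zero at the depot. -/
def ext0 (h : Vp → ℝ) (o : Option Vp) : ℝ := o.elim 0 h

/-- Indicator of a customer set. -/
def ind (S : Finset Vp) (v : Vp) : ℝ := if v ∈ S then 1 else 0

/-- Number of route edges inside `S`. -/
noncomputable def cnt (L : List Vp) (S : Finset Vp) : ℝ :=
  ∑ j ∈ range (L.length + 1), ext0 (ind S) (nodeAt L j) * ext0 (ind S) (nodeAt L (j + 1))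

lemma nodeAt_succ (L : List Vp) (j : ℕ) : nodeAt L (j + 1) = L[j]? := by
  simp [nodeAt]

lemma nodeAt_zero (L : List Vp) : nodeAt L 0 = none := by
  simp [nodeAt]

lemma list_sum_eq (L : List Vp) (h : Vp → ℝ) :
    (L.map h).sum = ∑ j ∈ range L.length, ext0 h (L[j]?) := by
  rw [← Fin.sum_univ_fun_getElem, Finset.sum_range]
  apply Finset.sum_congr rfl
  intro j _
  simp [ext0]

lemma ext0_ind_nonneg (S : Finset Vp) (o : Option Vp) : 0 ≤ ext0 (ind S) o := by
  cases o with
  | none => simp [ext0]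
  | some v => simp only [ext0, ind, Option.elim]; split_ifs <;> norm_num

lemma ext0_ind_le (S : Finset Vp) (o : Option Vp) : ext0 (ind S) o ≤ 1 := by
  cases o with
  | none => simp [ext0]
  | some v => simp only [ext0, ind, Option.elim]; split_ifs <;> norm_num

lemma route_cut (C : ℚ) (d : Vp → ℚ) (L : List Vp) (y : Vp → ℝ) (S : Finset Vp)
    (h : FlowFeasible C d L y) :
    (L.map (fun v => ind S v * ((d v : ℝ) - C * y v))).sum
      ≤ C * ((L.map (ind S)).sum - cnt L S) := by
  obtain ⟨f, g, hf, hg, hcons, hcap, hgc⟩ := h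
  set F : ℕ → ℝ := fun j => f (nodeAt L j) (nodeAt L (j + 1)) with hF
  set s : ℕ → ℝ := fun j => ext0 (ind S) (nodeAt L j) with hs
  have s0 : s 0 = 0 := by simp [hs, nodeAt_zero, ext0]
  have sl : s (L.length + 1) = 0 := by simp [hs, nodeAt_succ, ext0]
  have hs0 : ∀ j, 0 ≤ s j := fun j => ext0_ind_nonneg S _
  have hs1 : ∀ j, s j ≤ 1 := fun j => ext0_ind_le S _
  have hF0 : ∀ j, 0 ≤ F j := fun j => hf _ _
  have hFC : ∀ j, j < L.length + 1 → F j ≤ C := fun j hj => hcap ⟨j, hj⟩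
  rw [list_sum_eq, list_sum_eq]
  have e1 : ∑ j ∈ range L.length, ext0 (ind S) L[j]? = ∑ j ∈ range (L.length + 1), s j := by
    rw [Finset.sum_range_succ', s0, add_zero]
    simp [hs, nodeAt_succ]
  have e2 : ∑ j ∈ range L.length, s (j+1) * (F (j+1) - F j)
      = ∑ j ∈ range (L.length + 1), (s j - s (j+1)) * F j := by
    have h1 : ∑ j ∈ range (L.length + 1), s j * F j = ∑ j ∈ range L.length, s (j+1) * F (j+1) := by
      rw [Finset.sum_range_succ', s0]; simp
    have h2 : ∑ j ∈ range (L.length + 1), s (j+1) * F j = ∑ j ∈ range L.length, s (j+1) * F j := by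
      rw [Finset.sum_range_succ, sl]; simp
    simp only [mul_sub, sub_mul, Finset.sum_sub_distrib, h1, h2]
  rw [e1]
  calc _ ≤ ∑ j ∈ range L.length, s (j+1) * (F (j+1) - F j) := by
        apply Finset.sum_le_sum
        intro j hj
        have hj' := Finset.mem_range.mp hj
        have c := hcons ⟨j, hj'⟩
        have c2 := hgc ⟨j, hj'⟩
        have : s (j+1) = ind S L[j] := by simp [hs, nodeAt_succ, hj', ext0]
        simp only [List.get_eq_getElem] at c c2
        simp only [hj', getElem?_pos, ext0, Option.elim, this]
        apply mul_le_mul_of_nonneg_left _ (by rw [← this]; exact hs0 _)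
        simp only [hF]
        linarith
    _ = _ := e2
    _ ≤ ∑ j ∈ range (L.length + 1), (C : ℝ) * (s j - s j * s (j+1)) := by
        apply Finset.sum_le_sum
        intro j hj
        have := hFC j (Finset.mem_range.mp hj)
        have h3 : 0 ≤ s (j+1) * (1 - s j) * F j :=
          mul_nonneg (mul_nonneg (hs0 _) (by linarith [hs1 j])) (hF0 j)
        have h4 : 0 ≤ s j * (1 - s (j+1)) * (C - F j) :=
          mul_nonneg (mul_nonneg (hs0 _) (by linarith [hs1 (j+1)])) (by linarith)
        nlinarith
    _ = _ := by
        rw [← Finset.mul_sum, Finset.sum_sub_distrib]; rfl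

lemma pair_sum (S : Finset Vp) (o o' : Option Vp) (h : o = o' → o = none) :
    ∑ u ∈ S, ∑ v ∈ S.filter (fun v => v ≠ u),
      (if (o = some u ∧ o' = some v) ∨ (o = some v ∧ o' = some u) then (1:ℝ) else 0)
      = 2 * (ext0 (ind S) o * ext0 (ind S) o') := by
  cases o with
  | none => simp [ext0]
  | some a =>
    cases o' with
    | none => simp [ext0]
    | some c =>
      have hac : a ≠ c := fun e => by simpa using h (by rw [e])
      simp only [Option.some.injEq, ext0, Option.elim, ind]
      have : ∀ u ∈ S, ∀ v ∈ S.filter (fun v => v ≠ u),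
        (if (a = u ∧ c = v) ∨ (a = v ∧ c = u) then (1:ℝ) else 0)
          = (if a = u then (if c = v then 1 else 0) else 0)
            + (if c = u then (if a = v then 1 else 0) else 0) := by
        intro u _ v _
        by_cases h1 : a = u <;> by_cases h2 : c = v <;> by_cases h3 : a = v <;>
          by_cases h4 : c = u <;> simp_all
      rw [Finset.sum_congr rfl (fun u hu => Finset.sum_congr rfl (this u hu))]
      simp only [Finset.sum_add_distrib]
      have key : ∀ a c : Vp, a ≠ c → ∑ u ∈ S, ∑ v ∈ S.filter (fun v => v ≠ u),
          (if a = u then (if c = v then (1:ℝ) else 0) else 0)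
          = (if a ∈ S then 1 else 0) * (if c ∈ S then 1 else 0) := by
        intro a c hac
        have : ∀ u ∈ S, ∑ v ∈ S.filter (fun v => v ≠ u),
          (if a = u then (if c = v then (1:ℝ) else 0) else 0)
            = if a = u then (if c ∈ S then 1 else 0) else 0 := by
          intro u _
          by_cases h1 : a = u
          · subst h1
            simp [Finset.sum_ite_eq, hac.symm]
          · simp [h1]
        rw [Finset.sum_congr rfl this, Finset.sum_ite_eq]
        split_ifs <;> simp
      rw [key a c hac, key c a hac.symm]
      ring

lemma inSum_routeInc (L : List Vp) (hL : L ≠ []) (hn : L.Nodup) (S : Finset Vp) :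
    inSum (routeInc L) S = cnt L S := by
  unfold inSum routeInc cnt
  have : ∀ u ∈ S, (∑ v ∈ S.filter (fun v => v ≠ u), ∑ j ∈ range (L.length + 1),
      (if (nodeAt L j = some u ∧ nodeAt L (j+1) = some v) ∨
        (nodeAt L j = some v ∧ nodeAt L (j+1) = some u) then (1 : ℝ) else 0))
      = ∑ j ∈ range (L.length + 1), ∑ v ∈ S.filter (fun v => v ≠ u),
      (if (nodeAt L j = some u ∧ nodeAt L (j+1) = some v) ∨
        (nodeAt L j = some v ∧ nodeAt L (j+1) = some u) then (1 : ℝ) else 0) :=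
    fun u _ => Finset.sum_comm
  rw [Finset.sum_congr rfl this, Finset.sum_comm]
  have : ∀ j ∈ range (L.length + 1), (nodeAt L j = nodeAt L (j+1) → nodeAt L j = none) := by
    intro j hj e
    cases j with
    | zero => exact nodeAt_zero L
    | succ j =>
      rw [nodeAt_succ, nodeAt_succ] at e
      rw [nodeAt_succ]
      have hj' : j < L.length := by simpa using hj
      have := (List.getElem?_inj hj' hn).mp e
      omega
  rw [Finset.sum_congr rfl (fun j hj => pair_sum S _ _ (this j hj)), ← Finset.mul_sum]
  ring

lemma inSum_planInc (Rs : List (List Vp)) (h : ∀ L ∈ Rs, L ≠ [] ∧ L.Nodup) (S : Finset Vp) :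
    inSum (planInc Rs) S = (Rs.map (fun L => cnt L S)).sum := by
  induction Rs with
  | nil => simp [inSum, planInc]
  | cons L Rs ih =>
    rw [List.map_cons, List.sum_cons, ← ih (fun L hL => h L (by simp [hL])),
      ← inSum_routeInc L (h L (by simp)).1 (h L (by simp)).2]
    simp [inSum, planInc, Finset.sum_add_distrib, mul_add]

lemma cnt_nonneg (L : List Vp) (S : Finset Vp) : 0 ≤ cnt L S :=
  Finset.sum_nonneg fun _ _ => mul_nonneg (ext0_ind_nonneg _ _) (ext0_ind_nonneg _ _)

lemma cnt_int (L : List Vp) (S : Finset Vp) : ∃ m : ℤ, cnt L S = m := by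
  have h : ∀ o, ext0 (ind S) o = ((o.elim 0 (fun v => if v ∈ S then 1 else 0) : ℤ) : ℝ) := by
    intro o; cases o <;> simp [ext0, ind]
  refine ⟨∑ j ∈ range (L.length + 1), (nodeAt L j).elim 0 (fun v => if v ∈ S then 1 else 0) *
    (nodeAt L (j+1)).elim 0 (fun v => if v ∈ S then 1 else 0), ?_⟩
  simp only [cnt, h]
  push_cast
  rfl

lemma plan_int (Rs : List (List Vp)) (S : Finset Vp) :
    ∃ m : ℤ, (Rs.map (fun L => cnt L S)).sum = m := by
  induction Rs with
  | nil => exact ⟨0, by simp⟩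
  | cons L Rs ih =>
    obtain ⟨m, hm⟩ := ih
    obtain ⟨n, hn⟩ := cnt_int L S
    exact ⟨n + m, by simp [hm, hn]⟩

lemma plan_flat (Rs : List (List Vp)) (h : IsRoutingPlan Rs) :
    Rs.flatten.Nodup ∧ ∀ v, v ∈ Rs.flatten := by
  refine ⟨List.nodup_flatten.mpr ⟨fun L hL => (h.1 L hL).2, ?_⟩, ?_⟩
  · rw [List.pairwise_iff_get]
    intro i j hij v hi hj
    obtain ⟨w, _, hw⟩ := h.2 v
    have := (hw i hi).trans (hw j hj).symm
    exact absurd this hij.ne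
  · intro v
    obtain ⟨w, hw, _⟩ := h.2 v
    exact List.mem_flatten.mpr ⟨_, List.get_mem _ _, hw⟩

lemma sum_plan (Rs : List (List Vp)) (h : IsRoutingPlan Rs) (φ : Vp → ℝ) :
    ∑ v, φ v = (Rs.map (fun L => (L.map φ).sum)).sum := by
  obtain ⟨h1, h2⟩ := plan_flat Rs h
  have : (univ : Finset Vp) = Rs.flatten.toFinset := by
    ext v; simpa using h2 v
  rw [this, List.sum_toFinset _ h1, List.map_flatten, List.sum_flatten, List.map_map]
  rfl

lemma policy_sri (C : ℚ) (hC : 0 < C) (d : Vp → ℚ) (Rs : List (List Vp))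
    (hplan : IsRoutingPlan Rs) (y : Vp → ℝ) (hy : ∀ v, ∃ m : ℤ, y v = m)
    (hfl : ∀ L ∈ Rs, FlowFeasible C d L y) (S : Finset Vp) :
    (kxi C d S : ℝ) + inSum (planInc Rs) S - (S.card : ℝ) ≤ ∑ v ∈ S, y v := by
  rw [inSum_planInc Rs hplan.1]
  obtain ⟨M, hM⟩ := plan_int Rs S
  have hsub : ∀ φ : Vp → ℝ, ∑ v ∈ S, φ v = ∑ v, ind S v * φ v := by
    intro φ; simp [ind, Finset.sum_ite_mem]
  have h1 : ∑ v ∈ S, ((d v : ℝ) - C * y v) ≤ C * ((S.card : ℝ) - M) := by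
    have hc : (S.card : ℝ) = ∑ v, ind S v := by simp [ind]
    rw [hsub, hc, sum_plan Rs hplan, sum_plan Rs hplan, ← hM]
    calc _ ≤ (Rs.map (fun L => (C:ℝ) * ((L.map (ind S)).sum - cnt L S))).sum :=
          List.sum_le_sum fun L hL => route_cut C d L y S (hfl L hL)
      _ = _ := by
          rw [List.sum_map_mul_left]
          congr 1
          clear hM hfl hplan
          induction Rs with
          | nil => simp
          | cons L Rs ih => simp only [List.map_cons, List.sum_cons, ih]; ring
  choose m hm using hy
  rw [hM]
  have h2 : (kxi C d S) ≤ ∑ v ∈ S, m v + S.card - M := by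
    unfold kxi
    rw [Int.ceil_le, div_le_iff₀ hC]
    have h3 : ((∑ v ∈ S, d v : ℚ) : ℝ) ≤ (((∑ v ∈ S, m v + S.card - M : ℤ) : ℚ) * C : ℚ) := by
      push_cast
      rw [Finset.sum_sub_distrib, ← Finset.mul_sum] at h1
      simp only [hm] at h1
      nlinarith
    exact_mod_cast h3
  have h4 : (kxi C d S : ℝ) ≤ ((∑ v ∈ S, m v + S.card - M : ℤ) : ℝ) := by exact_mod_cast h2
  push_cast at h4
  simp only [hm]
  linarith

/-- Greedy flow. -/
noncomputable def greedy (q : ℕ → ℝ) : ℕ → ℝ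
  | 0 => 0
  | n + 1 => max 0 (greedy q n + q n)

lemma greedy_nonneg (q : ℕ → ℝ) (n : ℕ) : 0 ≤ greedy q n := by
  cases n with
  | zero => exact le_refl _
  | succ n => exact le_max_left _ _

lemma greedy_eq (q : ℕ → ℝ) (n : ℕ) :
    greedy q n = 0 ∨ ∃ a < n, greedy q n = ∑ j ∈ Ico a n, q j := by
  induction n with
  | zero => left; rfl
  | succ n ih =>
    rcases le_total (greedy q n + q n) 0 with h | h
    · left; exact max_eq_left h
    · right
      have e : greedy q (n+1) = greedy q n + q n := max_eq_right h
      rcases ih with h0 | ⟨a, ha, h0⟩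
      · exact ⟨n, by omega, by rw [e, h0]; simp⟩
      · exact ⟨a, by omega, by rw [e, h0, Finset.sum_Ico_succ_top ha.le]⟩

lemma seg_feasible (C : ℚ) (hC : 0 < C) (d : Vp → ℚ) (hd : ∀ v, 0 ≤ d v) (L : List Vp)
    (hn : L.Nodup) (y : Vp → ℝ) (hy : ∀ v, 0 ≤ y v)
    (hseg : ∀ a c, a < c → c ≤ L.length →
      ∑ j ∈ Ico a c, ext0 (fun v => (d v : ℝ) - C * y v) L[j]? ≤ C) :
    FlowFeasible C d L y := by
  have hC' : (0:ℝ) < C := by exact_mod_cast hC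
  have hd' : ∀ v, (0:ℝ) ≤ d v := fun v => by exact_mod_cast hd v
  set q : ℕ → ℝ := fun j => ext0 (fun v => (d v : ℝ) - C * y v) L[j]? with hq
  have hf : ∀ j, j < L.length + 1 →
      (nodeAt L j).elim 0 (fun v => greedy q (L.idxOf v + 1)) = greedy q j := by
    intro j hj
    cases j with
    | zero => simp [nodeAt_zero, greedy]
    | succ j =>
      have hj' : j < L.length := by omega
      simp [nodeAt_succ, hj', hn.idxOf_getElem]
  refine ⟨fun a _ => a.elim 0 (fun v => greedy q (L.idxOf v + 1)),
    fun v => min (greedy q (L.idxOf v) + d v) (C * y v), ?_, ?_, ?_, ?_, ?_⟩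
  · intro a _
    cases a with
    | none => exact le_refl _
    | some v => exact greedy_nonneg _ _
  · intro v
    exact le_min (add_nonneg (greedy_nonneg _ _) (hd' v)) (mul_nonneg hC'.le (hy v))
  · intro j
    have hj := j.2
    simp only []
    rw [hf _ (by omega), hf _ (by omega)]
    simp only [List.get_eq_getElem, hn.idxOf_getElem]
    have hqj : q j = (d L[j] : ℝ) - C * y L[j] := by simp [hq, ext0]
    simp only [greedy, hqj, Fin.getElem_fin]
    rcases le_total (greedy q j + ((d L[(j:ℕ)] : ℝ) - C * y L[(j:ℕ)])) 0 with h | h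
    · rw [max_eq_left h, min_eq_left (by linarith)]; ring
    · rw [max_eq_right h, min_eq_right (by linarith)]; ring
  · intro j
    simp only []
    rw [hf _ j.2]
    rcases greedy_eq q j with h | ⟨a, ha, h⟩
    · rw [h]; exact hC'.le
    · rw [h]; exact hseg a j ha (by omega)
  · intro j
    exact min_le_right _ _

/-- Customer set of a segment. -/
def segSet (L : List Vp) (a c : ℕ) : Finset Vp := ((L.drop a).take (c - a)).toFinset

lemma segSet_sum (L : List Vp) (hn : L.Nodup) (a c : ℕ) (hc : c ≤ L.length) (h : Vp → ℝ) :
    ∑ v ∈ segSet L a c, h v = ∑ j ∈ Ico a c, ext0 h L[j]? := by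
  unfold segSet
  have hT : ((L.drop a).take (c - a)).Nodup :=
    hn.sublist ((List.take_sublist _ _).trans (List.drop_sublist _ _))
  rw [List.sum_toFinset _ hT, list_sum_eq, Finset.sum_Ico_eq_sum_range]
  have : ((L.drop a).take (c - a)).length = c - a := by simp; omega
  rw [this]
  apply Finset.sum_congr rfl
  intro j hj
  have := Finset.mem_range.mp hj
  simp [List.getElem?_take, this]

lemma mem_segSet (L : List Vp) (a c j : ℕ) (ha : a ≤ j) (hj : j < c) (hc : c ≤ L.length) :
    L[j]'(by omega) ∈ segSet L a c := by
  unfold segSet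
  rw [List.mem_toFinset, List.mem_iff_getElem]
  refine ⟨j - a, by simp; omega, ?_⟩
  simp [Nat.add_sub_cancel' ha]

lemma cnt_seg (L : List Vp) (hn : L.Nodup) (a c : ℕ) (hac : a < c) (hc : c ≤ L.length) :
    ((segSet L a c).card : ℝ) - 1 ≤ cnt L (segSet L a c) := by
  have h1 : ((segSet L a c).card : ℝ) = (c : ℝ) - a := by
    have := segSet_sum L hn a c hc (fun _ => 1)
    rw [Finset.sum_const, nsmul_eq_mul, mul_one] at this
    rw [this, Finset.sum_congr rfl (g := fun _ => (1:ℝ))]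
    · simp [Nat.cast_sub hac.le]
    · intro j hj
      have := Finset.mem_Ico.mp hj
      have hj : j < L.length := by omega
      simp [ext0, hj]
  rw [h1]
  unfold cnt
  calc (c : ℝ) - a - 1 = ∑ j ∈ Ico (a+1) c, (1:ℝ) := by
        rw [Finset.sum_const, Nat.card_Ico, nsmul_eq_mul, Nat.cast_sub (by omega)]
        push_cast; ring
    _ ≤ ∑ j ∈ Ico (a+1) c, ext0 (ind (segSet L a c)) (nodeAt L j) *
          ext0 (ind (segSet L a c)) (nodeAt L (j + 1)) := by
        apply Finset.sum_le_sum
        intro j hj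
        have := Finset.mem_Ico.mp hj
        obtain ⟨i, rfl⟩ : ∃ i, j = i + 1 := ⟨j - 1, by omega⟩
        have h1 : i < L.length := by omega
        have h2 : i + 1 < L.length := by omega
        have m1 := mem_segSet L a c i (by omega) (by omega) hc
        have m2 := mem_segSet L a c (i+1) (by omega) (by omega) hc
        simp [nodeAt_succ, h1, h2, ext0, ind, m1, m2]
    _ ≤ _ := by
        apply Finset.sum_le_sum_of_subset_of_nonneg
        · intro j hj
          have := Finset.mem_Ico.mp hj
          exact Finset.mem_range.mpr (by omega)
        · intro j _ _
          exact mul_nonneg (ext0_ind_nonneg _ _) (ext0_ind_nonneg _ _)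

lemma inSum_seg (Rs : List (List Vp)) (h : ∀ L ∈ Rs, L ≠ [] ∧ L.Nodup) (L : List Vp)
    (hL : L ∈ Rs) (a c : ℕ) (hac : a < c) (hc : c ≤ L.length) :
    ((segSet L a c).card : ℝ) - 1 ≤ inSum (planInc Rs) (segSet L a c) := by
  rw [inSum_planInc Rs h]
  refine (cnt_seg L (h L hL).2 a c hac hc).trans ?_
  apply List.single_le_sum
  · intro x hx
    obtain ⟨L', _, rfl⟩ := List.mem_map.mp hx
    exact cnt_nonneg _ _
  · exact List.mem_map.mpr ⟨L, hL, rfl⟩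

/-- Position of a customer in the concatenation of all routes. -/
def rank (Rs : List (List Vp)) (v : Vp) : ℕ := Rs.flatten.idxOf v

lemma rank_route (Rs : List (List Vp)) (h : IsRoutingPlan Rs) (L : List Vp) (hL : L ∈ Rs) :
    ∃ off, ∀ j (hj : j < L.length), rank Rs L[j] = off + j := by
  obtain ⟨A, B, rfl⟩ := List.append_of_mem hL
  refine ⟨A.flatten.length, fun j hj => ?_⟩
  have hn := (plan_flat _ h).1
  unfold rank
  have hlt : A.flatten.length + j < (A ++ L :: B).flatten.length := by
    simp only [List.flatten_append, List.flatten_cons, List.length_append]; omega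
  have e : (A ++ L :: B).flatten[A.flatten.length + j] = L[j] := by
    simp only [List.flatten_append, List.flatten_cons]
    rw [List.getElem_append_right (by omega), List.getElem_append_left (by omega)]
    simp
  rw [← e, hn.idxOf_getElem]

lemma rank_inj (Rs : List (List Vp)) (h : IsRoutingPlan Rs) (u v : Vp)
    (e : rank Rs u = rank Rs v) : u = v :=
  (List.idxOf_inj ((plan_flat Rs h).2 u)).mp e

/-- Prefix sums. -/
noncomputable def pre (Rs : List (List Vp)) (y : Vp → ℝ) (n : ℕ) : ℝ :=
  ∑ u ∈ univ.filter (fun u => rank Rs u < n), y u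

lemma pre_succ (Rs : List (List Vp)) (h : IsRoutingPlan Rs) (y : Vp → ℝ) (v : Vp) :
    pre Rs y (rank Rs v + 1) = pre Rs y (rank Rs v) + y v := by
  unfold pre
  have : univ.filter (fun u => rank Rs u < rank Rs v + 1)
      = insert v (univ.filter (fun u => rank Rs u < rank Rs v)) := by
    ext u
    simp only [Finset.mem_filter, Finset.mem_univ, true_and, Finset.mem_insert]
    constructor
    · intro hu
      rcases Nat.lt_succ_iff_lt_or_eq.mp hu with h1 | h1
      · exact Or.inr h1
      · exact Or.inl (rank_inj Rs h _ _ h1)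
    · rintro (rfl | h1) <;> omega
  rw [this, Finset.sum_insert (by simp)]
  ring

/-- Threshold rounding. -/
noncomputable def rd (Rs : List (List Vp)) (y : Vp → ℝ) (t : ℝ) (v : Vp) : ℝ :=
  (⌊pre Rs y (rank Rs v + 1) + t⌋ : ℝ) - (⌊pre Rs y (rank Rs v) + t⌋ : ℝ)

lemma sum_tele (φ Φ : ℕ → ℝ) (a c : ℕ) (hac : a ≤ c)
    (h : ∀ j, a ≤ j → j < c → φ j = Φ (j+1) - Φ j) : ∑ j ∈ Ico a c, φ j = Φ c - Φ a := by
  induction c, hac using Nat.le_induction with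
  | base => simp
  | succ c hac ih =>
    rw [Finset.sum_Ico_succ_top hac, ih (fun j h1 h2 => h j h1 (by omega)),
      h c hac (by omega)]
    ring

lemma floor_diff_ge (A B t : ℝ) (k : ℤ) (h : (k:ℝ) ≤ B - A) :
    (k:ℝ) ≤ (⌊B + t⌋ : ℝ) - (⌊A + t⌋ : ℝ) := by
  have : k + ⌊A + t⌋ ≤ ⌊B + t⌋ := by
    rw [Int.le_floor]
    push_cast
    linarith [Int.floor_le (A + t)]
  have : (k:ℝ) + ⌊A + t⌋ ≤ ⌊B + t⌋ := by exact_mod_cast this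
  linarith

lemma floor_diff_le (A B t : ℝ) (k : ℤ) (h : B - A ≤ k) :
    (⌊B + t⌋ : ℝ) - (⌊A + t⌋ : ℝ) ≤ k := by
  have := floor_diff_ge B A t (-k) (by push_cast; linarith)
  push_cast at this
  linarith

lemma rd_feasible (C : ℚ) (hC : 0 < C) (d : Vp → ℚ) (hd : ∀ v, 0 ≤ d v) (Rs : List (List Vp))
    (hplan : IsRoutingPlan Rs) (y : Vp → ℝ) (hy : ∀ v, 0 ≤ y v)
    (hs : ∀ S : Finset Vp, S.Nonempty →
      (kxi C d S : ℝ) + inSum (planInc Rs) S - (S.card : ℝ) ≤ ∑ v ∈ S, y v) (t : ℝ)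
    (hr : ∀ v, 0 ≤ rd Rs y t v) (L : List Vp) (hL : L ∈ Rs) :
    FlowFeasible C d L (rd Rs y t) := by
  have hn := (hplan.1 L hL).2
  have hC' : (0:ℝ) < C := by exact_mod_cast hC
  apply seg_feasible C hC d hd L hn _ hr
  intro a c hac hc
  obtain ⟨off, hoff⟩ := rank_route Rs hplan L hL
  have e1 : ∑ v ∈ segSet L a c, y v = pre Rs y (off + c) - pre Rs y (off + a) := by
    rw [segSet_sum L hn a c hc]
    apply sum_tele _ (fun j => pre Rs y (off + j)) a c hac.le
    intro j h1 h2
    have hj : j < L.length := by omega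
    have := pre_succ Rs hplan y L[j]
    rw [hoff j hj] at this
    simp only [hj, getElem?_pos, ext0, Option.elim, ← add_assoc, this]
    ring
  have e2 : ∑ v ∈ segSet L a c, rd Rs y t v
      = (⌊pre Rs y (off + c) + t⌋ : ℝ) - (⌊pre Rs y (off + a) + t⌋ : ℝ) := by
    rw [segSet_sum L hn a c hc]
    apply sum_tele _ (fun j => (⌊pre Rs y (off + j) + t⌋ : ℝ)) a c hac.le
    intro j h1 h2
    have hj : j < L.length := by omega
    simp only [hj, getElem?_pos, ext0, Option.elim, rd, hoff j hj, ← add_assoc]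
  have hne : (segSet L a c).Nonempty := ⟨_, mem_segSet L a c a le_rfl hac hc⟩
  have h1 := hs _ hne
  have h2 := inSum_seg Rs hplan.1 L hL a c hac hc
  have h3 := floor_diff_ge (pre Rs y (off + a)) (pre Rs y (off + c)) t
    (kxi C d (segSet L a c) - 1) (by push_cast; rw [← e1]; linarith)
  rw [← e2] at h3
  rw [← segSet_sum L hn a c hc, Finset.sum_sub_distrib, ← Finset.mul_sum]
  have h4 : (∑ v ∈ segSet L a c, d v) ≤ (kxi C d (segSet L a c) : ℚ) * C := by
    rw [← div_le_iff₀ hC]; exact Int.le_ceil _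
  have h5 : (∑ v ∈ segSet L a c, (d v : ℝ)) ≤ (kxi C d (segSet L a c) : ℝ) * C := by
    exact_mod_cast h4
  push_cast at h3
  nlinarith

lemma floor_ii (a : ℝ) : IntervalIntegrable (fun t : ℝ => (⌊a + t⌋ : ℝ))
    MeasureTheory.volume 0 1 := by
  apply Monotone.intervalIntegrable
  intro s t hst
  have : ⌊a + s⌋ ≤ ⌊a + t⌋ := Int.floor_le_floor (by linarith)
  exact Int.cast_le.mpr this

lemma floor_int (a : ℝ) : ∫ t in (0:ℝ)..1, (⌊a + t⌋ : ℝ) = a := by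
  have hP : Function.Periodic (Int.fract : ℝ → ℝ) 1 := Int.fract_periodic ℝ
  have h1 : ∫ t in (0:ℝ)..1, Int.fract (a + t) = 1 / 2 := by
    rw [intervalIntegral.integral_comp_add_left (fun x : ℝ => Int.fract x) a, add_zero,
      hP.intervalIntegral_add_eq a 0, zero_add]
    have : ∫ t in (0:ℝ)..1, Int.fract t = ∫ t in (0:ℝ)..1, t := by
      apply intervalIntegral.integral_congr_ae
      have : ∀ᵐ x : ℝ, x ≠ 1 := by simp [MeasureTheory.ae_iff]
      filter_upwards [this] with x hx hx'
      rw [Set.uIoc_of_le zero_le_one] at hx'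
      exact Int.fract_eq_self.mpr ⟨hx'.1.le, lt_of_le_of_ne hx'.2 hx⟩
    rw [this]; simp
  have hi : IntervalIntegrable (fun t : ℝ => a + t) MeasureTheory.volume 0 1 :=
    (by fun_prop : Continuous fun t : ℝ => a + t).intervalIntegrable _ _
  have h2 : ∫ t in (0:ℝ)..1, Int.fract (a + t)
      = (∫ t in (0:ℝ)..1, (a + t)) - ∫ t in (0:ℝ)..1, (⌊a + t⌋ : ℝ) := by
    rw [← intervalIntegral.integral_sub hi (floor_ii a)]
    rfl
  have h3 : ∫ t in (0:ℝ)..1, (a + t) = a + 1/2 := by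
    rw [intervalIntegral.integral_add (by simp) (by simp)]; simp
  rw [h1, h3] at h2
  linarith

lemma rd_ii (Rs : List (List Vp)) (y : Vp → ℝ) (v : Vp) :
    IntervalIntegrable (fun t => rd Rs y t v) MeasureTheory.volume 0 1 :=
  (floor_ii _).sub (floor_ii _)

lemma rd_int (Rs : List (List Vp)) (h : IsRoutingPlan Rs) (y : Vp → ℝ) (v : Vp) :
    ∫ t in (0:ℝ)..1, rd Rs y t v = y v := by
  unfold rd
  rw [intervalIntegral.integral_sub (floor_ii _) (floor_ii _), floor_int, floor_int,
    pre_succ Rs h]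
  ring

/-- Theorem 2 of the paper: for every integer routing plan `x̄ ∈ 𝒳 ∩ ℤ^E`,
`SRI(x̄) = conv(Π(x̄) ∩ [0,b]^N)`. -/
theorem statement_7
    (C : ℚ) (hC : 0 < C) (d : Sc → Vp → ℚ)
    (hd : ∀ ξ v, 0 ≤ d ξ v) (hdC : ∀ ξ v, d ξ v ≤ C)
    (p : Sc → ℚ) (hp : ∀ ξ, 0 ≤ p ξ) (hps : ∑ ξ, p ξ = 1)
    (k : ℕ) (hk : 0 < k)
    (X : Set (Option Vp → Option Vp → ℝ)) (hX : X = Xsub ∨ X = Xcvrp C p d k)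
    (b : Vp → ℤ) (hb : ∀ v, 0 ≤ b v)
    (Rs : List (List Vp)) (hplan : IsRoutingPlan Rs)
    (hmem : planInc Rs ∈ X) :
    SRIy C d b (planInc Rs)
      = convexHull ℝ ((⋂ i : Fin Rs.length, Policies C d (Rs.get i)) ∩ Box b) := by

  apply Set.Subset.antisymm
  · rintro y ⟨hbox, hsri⟩
    set K : Set (Sc → Vp → ℝ) := (⋂ i : Fin Rs.length, Policies C d (Rs.get i)) ∩ Box b with hK
    have hfin : K.Finite := by
      have hF : {z : Sc → Vp → ℝ | ∀ ξ, z ξ ∈ {w : Vp → ℝ | ∀ v, w v ∈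
          (fun m : ℤ => (m : ℝ)) '' Set.Icc 0 (b v)}}.Finite :=
        Set.Finite.pi' fun ξ => Set.Finite.pi' fun v => (Set.finite_Icc _ _).image _
      refine hF.subset ?_
      rintro z ⟨hz, hzb⟩ ξ v
      obtain ⟨i, -⟩ := hplan.2 v
      obtain ⟨m, hm⟩ := ((Set.mem_iInter.mp hz i) ξ).2.1 v
      have hv := hzb ξ v
      rw [hm] at hv
      exact ⟨m, ⟨by exact_mod_cast hv.1, by exact_mod_cast hv.2⟩, hm.symm⟩
    have hmemK : ∀ t : ℝ, (fun ξ => rd Rs (y ξ) t) ∈ K := by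
      intro t
      have hr : ∀ ξ v, 0 ≤ rd Rs (y ξ) t v := by
        intro ξ v
        have := floor_diff_ge (pre Rs (y ξ) (rank Rs v)) (pre Rs (y ξ) (rank Rs v + 1)) t 0
          (by rw [pre_succ Rs hplan]; push_cast; linarith [(hbox ξ v).1])
        simpa [rd] using this
      refine ⟨Set.mem_iInter.mpr fun i ξ => ⟨hr ξ, fun v => ?_, ?_⟩, fun ξ v => ⟨hr ξ v, ?_⟩⟩
      · exact ⟨⌊pre Rs (y ξ) (rank Rs v + 1) + t⌋ - ⌊pre Rs (y ξ) (rank Rs v) + t⌋, by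
          simp [rd]⟩
      · exact rd_feasible C hC (d ξ) (hd ξ) Rs hplan (y ξ) (fun v => (hbox ξ v).1)
          (fun S hS => hsri S hS ξ) t (hr ξ) _ (List.get_mem _ _)
      · apply floor_diff_le
        rw [pre_succ Rs hplan]
        linarith [(hbox ξ v).2]
    have hpm : MeasureTheory.IsProbabilityMeasure
        (MeasureTheory.volume.restrict (Set.Ioc (0:ℝ) 1)) := ⟨by simp⟩
    have hi1 : ∀ ξ v, MeasureTheory.Integrable (fun t => rd Rs (y ξ) t v)
        (MeasureTheory.volume.restrict (Set.Ioc (0:ℝ) 1)) := fun ξ v =>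
      (intervalIntegrable_iff_integrableOn_Ioc_of_le zero_le_one).mp (rd_ii Rs (y ξ) v)
    have hi2 : ∀ ξ, MeasureTheory.Integrable (fun t => rd Rs (y ξ) t)
        (MeasureTheory.volume.restrict (Set.Ioc (0:ℝ) 1)) := fun ξ =>
      MeasureTheory.Integrable.of_eval (hi1 ξ)
    have hmain := Convex.integral_mem (μ := MeasureTheory.volume.restrict (Set.Ioc (0:ℝ) 1))
      (f := fun t ξ => rd Rs (y ξ) t) (convex_convexHull ℝ K)
      (hfin.isCompact_convexHull ℝ).isClosed
      (Filter.Eventually.of_forall fun t => subset_convexHull ℝ K (hmemK t))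
      (MeasureTheory.Integrable.of_eval hi2)
    convert hmain using 1
    funext ξ v
    rw [MeasureTheory.eval_integral hi2, MeasureTheory.eval_integral (hi1 ξ),
      ← intervalIntegral.integral_of_le zero_le_one, rd_int Rs hplan]
  · apply convexHull_min
    · rintro y ⟨hy, hbox⟩
      refine ⟨hbox, fun S _ ξ => ?_⟩
      apply policy_sri C hC (d ξ) Rs hplan
      · intro v
        obtain ⟨i, -⟩ := hplan.2 v
        exact ((Set.mem_iInter.mp hy i) ξ).2.1 v
      · intro L hL
        obtain ⟨i, rfl⟩ := List.get_of_mem hL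
        exact ((Set.mem_iInter.mp hy i) ξ).2.2
    · rintro y ⟨hy1, hy2⟩ z ⟨hz1, hz2⟩ α β hα hβ hαβ
      refine ⟨fun ξ v => ?_, fun S hS ξ => ?_⟩
      · have h1 := hy1 ξ v
        have h2 := hz1 ξ v
        simp only [Pi.add_apply, Pi.smul_apply, smul_eq_mul]
        constructor
        · exact add_nonneg (mul_nonneg hα h1.1) (mul_nonneg hβ h2.1)
        · have := mul_le_mul_of_nonneg_left h1.2 hα
          have := mul_le_mul_of_nonneg_left h2.2 hβ
          calc _ ≤ α * (b v : ℝ) + β * b v := by linarith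
            _ = b v := by rw [← add_mul, hαβ, one_mul]
      · have h1 := mul_le_mul_of_nonneg_left (hy2 S hS ξ) hα
        have h2 := mul_le_mul_of_nonneg_left (hz2 S hS ξ) hβ
        simp only [Pi.add_apply, Pi.smul_apply, smul_eq_mul, Finset.sum_add_distrib,
          ← Finset.mul_sum]
        refine le_trans ?_ (add_le_add h1 h2)
        rw [← add_mul, hαβ, one_mul]

end VRPSD
end
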